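/- arXiv:math/0308221 — 2 statements merged into one kernel-verified Lean document; each statement's English description precedes it below -/
import Mathlib

section
/- Let r_i = 1 + e_i⊗α_i (i = 1,2,3) be invertible pseudo-reflections in GL(3,ℂ) (so t_i² := 1 + α_i(e_i) ≠ 0). Then α₁(e₂)·α₂(e₃)·α₃(e₁) = t₃²t₁₂ + t₂²t₁₃ + t₁²t₂₃ − t₁²t₂² − t₂²t₃² − t₁²t₃² − t₃₂₁′, where t_{ij} := Tr(r_ir_j) − 1 and t₃₂₁′ := det(r₃r₂r₁)·Tr((r₃r₂r₁)⁻¹). -/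
open Matrix

theorem Matrix.det_one_add_vecMulVec {n R : Type*} [Fintype n] [DecidableEq n] [CommRing R]
    (v w : n → R) : (1 + vecMulVec v w).det = 1 + w ⬝ᵥ v := by
  rw [vecMulVec_eq Unit, det_one_add_replicateCol_mul_replicateRow]

theorem Matrix.adjugate_one_add_vecMulVec_fin_three {R : Type*} [CommRing R] (v w : Fin 3 → R) :
    (1 + vecMulVec v w).adjugate = (1 + w ⬝ᵥ v) • 1 - vecMulVec v w := by
  ext i j
  fin_cases i <;> fin_cases j <;>
    simp [adjugate_fin_three, vecMulVec_apply, dotProduct, Fin.sum_univ_three] <;> ring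

theorem Matrix.det_mul_trace_inv {n K : Type*} [Fintype n] [DecidableEq n] [Field K]
    {A : Matrix n n K} (hA : A.det ≠ 0) : A.det * A⁻¹.trace = A.adjugate.trace := by
  rw [inv_def, trace_smul, Ring.inverse_eq_inv', smul_eq_mul, mul_inv_cancel_left₀ hA]

/-- For a triple of invertible pseudo-reflections `rᵢ = 1 + eᵢ⊗αᵢ` in GL(3,ℂ):
`u₁₂u₂₃u₃₁ = t₃²t₁₂ + t₂²t₁₃ + t₁²t₂₃ − t₁²t₂² − t₂²t₃² − t₁²t₃² − t₃₂₁′`.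
Here `r 0, r 1, r 2` play the roles of `r₁, r₂, r₃`, and `tᵢ² = 1 + αᵢ(eᵢ)`. -/
theorem stmt4 (e a : Fin 3 → Fin 3 → ℂ)
    (ht : ∀ i, 1 + a i ⬝ᵥ e i ≠ 0)
    (r : Fin 3 → Matrix (Fin 3) (Fin 3) ℂ)
    (hr : ∀ i, r i = 1 + vecMulVec (e i) (a i)) :
    (a 0 ⬝ᵥ e 1) * (a 1 ⬝ᵥ e 2) * (a 2 ⬝ᵥ e 0) =
      (1 + a 2 ⬝ᵥ e 2) * ((r 0 * r 1).trace - 1)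
      + (1 + a 1 ⬝ᵥ e 1) * ((r 0 * r 2).trace - 1)
      + (1 + a 0 ⬝ᵥ e 0) * ((r 1 * r 2).trace - 1)
      - (1 + a 0 ⬝ᵥ e 0) * (1 + a 1 ⬝ᵥ e 1)
      - (1 + a 1 ⬝ᵥ e 1) * (1 + a 2 ⬝ᵥ e 2)
      - (1 + a 0 ⬝ᵥ e 0) * (1 + a 2 ⬝ᵥ e 2)
      - (r 2 * r 1 * r 0).det * ((r 2 * r 1 * r 0)⁻¹).trace := by
  have hdet : (r 2 * r 1 * r 0).det ≠ 0 := by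
    simp only [det_mul, hr, det_one_add_vecMulVec]
    exact mul_ne_zero (mul_ne_zero (ht 2) (ht 1)) (ht 0)
  rw [det_mul_trace_inv hdet]
  simp only [adjugate_mul_distrib, hr, adjugate_one_add_vecMulVec_fin_three]
  simp only [mul_add, add_mul, mul_sub, sub_mul, one_mul, mul_one, smul_mul_assoc, mul_smul_comm,
    vecMulVec_mul_vecMulVec, vecMulVec_smul, trace_add, trace_sub, trace_smul,
    trace_one, trace_vecMulVec, smul_eq_mul, smul_sub,
    Fintype.card_fin, dotProduct_comm (e _) (a _)]
  push_cast
  ring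
end

section
/- Let Y, T : ℂ → ℂ be the functions given outside the zeros of their denominators by Y(s) := −(5s²−8s+5)(7s²−7s+4)/(s(s−2)(s+1)(2s−1)(4s²−7s+7)) and T(s) := (7s²−7s+4)²/(s³(4s²−7s+7)²). Fix s ∈ ℂ such that s(s−2)(s+1)(2s−1)(4s²−7s+7) ≠ 0, T′(s) ≠ 0, T(s) ∉ {0,1}, and Y(s) ∉ {0, 1, T(s)}. Set t := T(s), y := Y(s), y′ := Y′(s)/T′(s), and y″ := (Y″(s)·T′(s) − Y′(s)·T″(s))/T′(s)³ (where ′ denotes the complex derivative). Then the Painlevé VI equation with parameters (α, β, γ, δ) = (9/98, −4/98, 4/98, 45/98) is satisfied: y″ = (1/2)(1/y + 1/(y−1) + 1/(y−t))·(y′)² − (1/t + 1/(t−1) + 1/(y−t))·y′ + (y(y−1)(y−t)/(t²(t−1)²))·(α + β·t/y² + γ·(t−1)/(y−1)² + δ·t(t−1)/(y−t)²). -/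
/-- The rational parameterisation of the Klein solution: `y`-coordinate. -/
noncomputable def kleinY (s : ℂ) : ℂ :=
  -((5*s^2 - 8*s + 5) * (7*s^2 - 7*s + 4)) /
    (s * (s - 2) * (s + 1) * (2*s - 1) * (4*s^2 - 7*s + 7))

/-- The rational parameterisation of the Klein solution: `t`-coordinate. -/
noncomputable def kleinT (s : ℂ) : ℂ :=
  (7*s^2 - 7*s + 4)^2 / (s^3 * (4*s^2 - 7*s + 7)^2)

/-- The derivative of `kleinT`, away from the poles. -/
theorem hasDerivAt_kleinT {s : ℂ} (hs : s ≠ 0) (hq : 4*s^2 - 7*s + 7 ≠ 0) :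
    HasDerivAt kleinT
      (-21 * ((s - 1)^2 * (7*s^2 - 7*s + 4) * (4*s^2 - s + 4)) / (s^4 * (4*s^2 - 7*s + 7)^3)) s := by
  have hx := hasDerivAt_id' s
  have hp := (((hx.pow 2).const_mul 7).sub (hx.const_mul 7)).add_const 4
  have hq' := (((hx.pow 2).const_mul 4).sub (hx.const_mul 7)).add_const 7
  refine ((hp.pow 2).div ((hx.pow 3).mul (hq'.pow 2)) ?_).congr_deriv ?_
  · simpa using ⟨hs, hq⟩
  · simp
    field_simp
    ring

/-- The numerator of `dy/dt` along the Klein solution. -/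
noncomputable def kleinSlopeNum (s : ℂ) : ℂ :=
  -560*s^8 + 2534*s^7 - 5750*s^6 + 7961*s^5 - 7523*s^4 + 3467*s^3 + 151*s^2 - 1120*s + 280

/-- The derivative `dy/dt` along the Klein solution, as a function of the parameter. -/
noncomputable def kleinSlope (s : ℂ) : ℂ :=
  s^2 * (4*s^2 - 7*s + 7) * kleinSlopeNum s /
    (21 * ((s - 2) * (s + 1) * (2*s - 1))^2 *
      ((s - 1) * (7*s^2 - 7*s + 4) * (4*s^2 - s + 4)))

/-- The numerator of the derivative of `kleinSlope`. -/
noncomputable def kleinSlopeDerivNum (s : ℂ) : ℂ :=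
  -125440*s^18 + 1128960*s^17 - 3540096*s^16 + 2731008*s^15 + 17571996*s^14 - 81232452*s^13
    + 199426404*s^12 - 348942564*s^11 + 475383312*s^10 - 524927696*s^9 + 475383312*s^8
    - 348942564*s^7 + 199426404*s^6 - 81232452*s^5 + 17571996*s^4 + 2731008*s^3
    - 3540096*s^2 + 1128960*s - 125440

/-- The derivative of `kleinY`, away from the poles. -/
theorem hasDerivAt_kleinY {s : ℂ}
    (hden : s * (s - 2) * (s + 1) * (2*s - 1) * (4*s^2 - 7*s + 7) ≠ 0) :
    HasDerivAt kleinY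
      (-((s - 1) * kleinSlopeNum s) /
        (s * (s - 2) * (s + 1) * (2*s - 1) * (4*s^2 - 7*s + 7))^2) s := by
  have hx := hasDerivAt_id' s
  have hr := (((hx.pow 2).const_mul 5).sub (hx.const_mul 8)).add_const 5
  have hp := (((hx.pow 2).const_mul 7).sub (hx.const_mul 7)).add_const 4
  have hq := (((hx.pow 2).const_mul 4).sub (hx.const_mul 7)).add_const 7
  refine ((hr.mul hp).neg.div ((((hx.mul (hx.sub_const 2)).mul (hx.add_const 1)).mul
    ((hx.const_mul 2).sub_const 1)).mul hq) hden).congr_deriv ?_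
  unfold kleinSlopeNum
  congr 1
  simp
  ring

/-- The derivative of `kleinSlope`, away from the poles. -/
theorem hasDerivAt_kleinSlope {s : ℂ} (h2 : s - 2 ≠ 0) (h1 : s + 1 ≠ 0) (hh : 2*s - 1 ≠ 0)
    (hs1 : s - 1 ≠ 0) (hp : 7*s^2 - 7*s + 4 ≠ 0) (hw : 4*s^2 - s + 4 ≠ 0) :
    HasDerivAt kleinSlope
      (s * kleinSlopeDerivNum s / (21 * ((s - 2) * (s + 1) * (2*s - 1))^3 *
        ((s - 1) * (7*s^2 - 7*s + 4) * (4*s^2 - s + 4))^2)) s := by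
  have hx := hasDerivAt_id' s
  have hN : HasDerivAt kleinSlopeNum (-4480*s^7 + 17738*s^6 - 34500*s^5 + 39805*s^4 - 30092*s^3
      + 10401*s^2 + 302*s - 1120) s := by
    refine ((((((((((hx.pow 8).const_mul (-560)).add ((hx.pow 7).const_mul 2534)).sub
      ((hx.pow 6).const_mul 5750)).add ((hx.pow 5).const_mul 7961)).sub
      ((hx.pow 4).const_mul 7523)).add ((hx.pow 3).const_mul 3467)).add
      ((hx.pow 2).const_mul 151)).sub (hx.const_mul 1120)).add_const 280).congr_deriv ?_
    simp
    ring
  have hp' := (((hx.pow 2).const_mul 7).sub (hx.const_mul 7)).add_const 4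
  have hq' := (((hx.pow 2).const_mul 4).sub (hx.const_mul 7)).add_const 7
  have hw' := (((hx.pow 2).const_mul 4).sub hx).add_const 4
  have hA := ((hx.sub_const 2).mul (hx.add_const 1)).mul ((hx.const_mul 2).sub_const 1)
  refine ((((hx.pow 2).mul hq').mul hN).div (((hA.pow 2).const_mul 21).mul
    (((hx.sub_const 1).mul hp').mul hw')) ?_).congr_deriv ?_
  · simpa using ⟨⟨⟨h2, h1⟩, hh⟩, ⟨hs1, hp⟩, hw⟩
  · simp only [Pi.mul_apply, Pi.pow_apply, Pi.sub_apply, Nat.cast_ofNat]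
    norm_num only
    generalize hq' : 4*s^2 - 7*s + 7 = q
    generalize hp' : 7*s^2 - 7*s + 4 = p at hp ⊢
    generalize hw' : 4*s^2 - s + 4 = w at hw ⊢
    generalize ha' : s - 2 = a at h2 ⊢
    generalize hb' : s + 1 = b at h1 ⊢
    generalize hc' : 2*s - 1 = c at hh ⊢
    generalize hd' : s - 1 = d at hs1 ⊢
    field_simp
    subst hq' hp' hw' ha' hb' hc' hd'
    unfold kleinSlopeNum kleinSlopeDerivNum
    ring

/-- The implicitly defined function `y(t)` parameterised by `(kleinT, kleinY)`
satisfies the Painlevé VI equation with parameters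
`(α,β,γ,δ) = (9,−4,4,45)/98`. -/
theorem stmt18 (s : ℂ)
    (hden : s * (s - 2) * (s + 1) * (2*s - 1) * (4*s^2 - 7*s + 7) ≠ 0)
    (hT' : deriv kleinT s ≠ 0)
    (hT0 : kleinT s ≠ 0) (hT1 : kleinT s ≠ 1)
    (hY0 : kleinY s ≠ 0) (hY1 : kleinY s ≠ 1) (hYT : kleinY s ≠ kleinT s) :
    (deriv (deriv kleinY) s * deriv kleinT s - deriv kleinY s * deriv (deriv kleinT) s)
        / (deriv kleinT s)^3 =
      (1/2) * (1 / kleinY s + 1 / (kleinY s - 1) + 1 / (kleinY s - kleinT s))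
          * (deriv kleinY s / deriv kleinT s)^2
      - (1 / kleinT s + 1 / (kleinT s - 1) + 1 / (kleinY s - kleinT s))
          * (deriv kleinY s / deriv kleinT s)
      + (kleinY s * (kleinY s - 1) * (kleinY s - kleinT s)
          / (kleinT s^2 * (kleinT s - 1)^2))
        * ((9 : ℂ)/98 + (-4 : ℂ)/98 * kleinT s / kleinY s^2
            + (4 : ℂ)/98 * (kleinT s - 1) / (kleinY s - 1)^2
            + (45 : ℂ)/98 * (kleinT s * (kleinT s - 1)) / (kleinY s - kleinT s)^2) := by
  have hden' := hden
  simp only [mul_ne_zero_iff] at hden'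
  obtain ⟨⟨⟨⟨hs, h2⟩, h1⟩, hh⟩, hq⟩ := hden'
  have dT := (hasDerivAt_kleinT hs hq).deriv
  obtain ⟨⟨hs1, hp⟩, hw⟩ : (s - 1 ≠ 0 ∧ 7*s^2 - 7*s + 4 ≠ 0) ∧ 4*s^2 - s + 4 ≠ 0 := by
    refine ⟨⟨?_, ?_⟩, ?_⟩ <;> intro h <;> exact hT' (by rw [dT, h]; simp)
  have hslope : deriv kleinY =ᶠ[nhds s] fun z ↦ kleinSlope z * deriv kleinT z := by
    have hnear : ∀ᶠ z in nhds s, z * (z - 2) * (z + 1) * (2*z - 1) * (4*z^2 - 7*z + 7) ≠ 0 :=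
      ContinuousAt.eventually_ne (by fun_prop) hden
    have hnear' : ∀ᶠ z in nhds s, (z - 1) * (7*z^2 - 7*z + 4) * (4*z^2 - z + 4) ≠ 0 :=
      ContinuousAt.eventually_ne (by fun_prop) (mul_ne_zero (mul_ne_zero hs1 hp) hw)
    filter_upwards [hnear, hnear'] with z hz hz'
    rw [(hasDerivAt_kleinY hz).deriv]
    simp only [mul_ne_zero_iff] at hz hz'
    clear hs h2 h1 hh hq hs1 hp hw
    obtain ⟨⟨⟨⟨hs, h2⟩, h1⟩, hh⟩, hq⟩ := hz
    obtain ⟨⟨hs1, hp⟩, hw⟩ := hz'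
    rw [(hasDerivAt_kleinT hs hq).deriv, kleinSlope]
    generalize 4*z^2 - 7*z + 7 = q at *
    generalize 7*z^2 - 7*z + 4 = p at *
    generalize 4*z^2 - z + 4 = w at *
    field_simp
  have hdT : DifferentiableAt ℂ (deriv kleinT) s := by
    have hnear : ∀ᶠ z in nhds s, z ≠ 0 ∧ 4*z^2 - 7*z + 7 ≠ 0 :=
      (ContinuousAt.eventually_ne (by fun_prop) hs).and
        (ContinuousAt.eventually_ne (by fun_prop) hq)
    have heq : deriv kleinT =ᶠ[nhds s] fun z ↦
        -21 * ((z - 1)^2 * (7*z^2 - 7*z + 4) * (4*z^2 - z + 4)) / (z^4 * (4*z^2 - 7*z + 7)^3) := by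
      filter_upwards [hnear] with z hz
      exact (hasDerivAt_kleinT hz.1 hz.2).deriv
    refine DifferentiableAt.congr_of_eventuallyEq ?_ heq
    exact DifferentiableAt.div (by fun_prop) (by fun_prop)
      (mul_ne_zero (pow_ne_zero _ hs) (pow_ne_zero _ hq))
  have dS := hasDerivAt_kleinSlope h2 h1 hh hs1 hp hw
  have ddY : deriv (deriv kleinY) s = deriv kleinSlope s * deriv kleinT s
      + kleinSlope s * deriv (deriv kleinT) s := by
    rw [hslope.deriv_eq]
    exact deriv_fun_mul dS.differentiableAt hdT
  have dY : deriv kleinY s = kleinSlope s * deriv kleinT s := hslope.eq_of_nhds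
  have hl : (deriv (deriv kleinY) s * deriv kleinT s
      - deriv kleinY s * deriv (deriv kleinT) s) / (deriv kleinT s)^3
        = deriv kleinSlope s / deriv kleinT s := by
    rw [ddY, dY]
    field_simp
    ring
  have hr : deriv kleinY s / deriv kleinT s = kleinSlope s := by
    rw [dY, mul_div_cancel_right₀ _ hT']
  have eY1 : kleinY s - 1 = -((s - 1)^2 * (4*s^2 - s + 4) * (2*s^2 - 2*s + 5)) /
      (s * (s - 2) * (s + 1) * (2*s - 1) * (4*s^2 - 7*s + 7)) := by
    rw [kleinY, div_sub_one hden]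
    congr 1
    ring
  have eT1 : kleinT s - 1 = -((s - 1)^3 * (4*s^2 - s + 4)^2) /
      (s^3 * (4*s^2 - 7*s + 7)^2) := by
    rw [kleinT, div_sub_one (mul_ne_zero (pow_ne_zero 3 hs) (pow_ne_zero 2 hq))]
    congr 1
    ring
  have eYT : kleinY s - kleinT s =
      -((s - 1)^2 * (7*s^2 - 7*s + 4) * (4*s^2 - s + 4) * (5*s^2 - 2*s + 2)) /
        (s^3 * (s - 2) * (s + 1) * (2*s - 1) * (4*s^2 - 7*s + 7)^2) := by
    rw [kleinY, kleinT]
    generalize hq' : 4*s^2 - 7*s + 7 = q at hq ⊢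
    generalize hh' : 2*s - 1 = c at hh ⊢
    field_simp
    subst hq' hh'
    ring
  have hr5 : 5*s^2 - 8*s + 5 ≠ 0 := fun h ↦ hY0 (by rw [kleinY, h]; simp)
  have hv : 2*s^2 - 2*s + 5 ≠ 0 := fun h ↦ sub_ne_zero.2 hY1 (by rw [eY1, h]; simp)
  have hu : 5*s^2 - 2*s + 2 ≠ 0 := fun h ↦ sub_ne_zero.2 hYT (by rw [eYT, h]; simp)
  rw [hl, hr, dS.deriv, dT, eY1, eT1, eYT, kleinY, kleinT, kleinSlope]
  generalize hq' : 4*s^2 - 7*s + 7 = q at hq ⊢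
  generalize hp' : 7*s^2 - 7*s + 4 = p at hp ⊢
  generalize hw' : 4*s^2 - s + 4 = w at hw ⊢
  generalize hr' : 5*s^2 - 8*s + 5 = r at hr5 ⊢
  generalize hv' : 2*s^2 - 2*s + 5 = v at hv ⊢
  generalize hu' : 5*s^2 - 2*s + 2 = u at hu ⊢
  generalize ha' : s - 2 = a at h2 ⊢
  generalize hb' : s + 1 = b at h1 ⊢
  generalize hc' : 2*s - 1 = c at hh ⊢
  generalize hd' : s - 1 = d at hs1 ⊢
  field_simp
  subst hq' hp' hw' hr' hv' hu' ha' hb' hc' hd'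
  unfold kleinSlopeDerivNum kleinSlopeNum
  ring
end
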